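/- Let θ ∈ ℝ/ℤ be an angle that is not periodic under the doubling map and not recurrent under doubling (θ does not lie in the closure of {2ⁿθ : n ≥ 1}). Then for every c ∈ (0,1) there exists δ > 0 such that every angle φ with 0 < dist(φ, θ) < δ satisfies diff(ν(θ), ν(φ)) > c·n, where n is the unique integer with 2^{−n−1} ≤ dist(φ, θ) < 2^{−n}. -/

import Mathlib

noncomputable instance : Fact ((0:ℝ) < 1) := ⟨one_pos⟩

/-- The representative in `[0,1)` of a point of the circle `ℝ/ℤ`. -/
noncomputable def rep (x : AddCircle (1 : ℝ)) : ℝ :=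
  (AddCircle.equivIco 1 0 x : ℝ)

open Classical in
/-- The kneading sequence of the angle `θ`: with `t ∈ [0,1)` the representative of `θ`,
the `k`-th entry records whether `2^(k-1) θ` lies in the open arc `A₁ = (t/2, (t+1)/2)`
containing `θ`, in the complementary open arc `A₀`, or is one of the two boundary points
`θ/2, (θ+1)/2` (the symbol `⋆`, encoded as `none`). Positions start at `1`. -/
noncomputable def nu (θ : AddCircle (1 : ℝ)) (k : ℕ) : Option Bool :=
  let t := rep θ
  let x := rep ((2 ^ (k - 1) : ℕ) • θ)
  if x = t / 2 ∨ x = (t + 1) / 2 then none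
  else if t / 2 < x ∧ x < (t + 1) / 2 then some true
  else some false

/-- Position of the first genuinely different entry (positions `≥ 1`), with `⋆ = none`
acting as a wildcard; `∞` if there is none. -/
noncomputable def diffW (a b : ℕ → Option Bool) : ℕ∞ :=
  sInf {k : ℕ∞ | ∃ n : ℕ, k = (n : ℕ∞) ∧ 1 ≤ n ∧
    ∃ x y : Bool, a n = some x ∧ b n = some y ∧ x ≠ y}


/-- `θ` is periodic under the angle-doubling map. -/
def DoublingPeriodic (θ : AddCircle (1 : ℝ)) : Prop :=
  ∃ n, 1 ≤ n ∧ (2 ^ n : ℕ) • θ = θ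

/-- `θ` is recurrent under the angle-doubling map. -/
def DoublingRecurrent (θ : AddCircle (1 : ℝ)) : Prop :=
  θ ∈ closure {x : AddCircle (1 : ℝ) | ∃ n, 1 ≤ n ∧ x = (2 ^ n : ℕ) • θ}

lemma coe_rep (x : AddCircle (1 : ℝ)) : ((rep x : ℝ) : AddCircle (1 : ℝ)) = x :=
  AddCircle.coe_equivIco

lemma rep_mem (x : AddCircle (1 : ℝ)) : 0 ≤ rep x ∧ rep x < 1 := by
  obtain ⟨h₀, h₁⟩ := (AddCircle.equivIco 1 0 x).2
  exact ⟨h₀, h₁.trans_eq (zero_add 1)⟩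

lemma norm_coe_le_abs_sub_int (a : ℝ) (k : ℤ) : ‖(a : AddCircle (1 : ℝ))‖ ≤ |a - k| := by
  rw [AddCircle.norm_eq]
  simpa using round_le a k

lemma exists_int_norm_coe (a : ℝ) : ∃ k : ℤ, ‖(a : AddCircle (1 : ℝ))‖ = |a - k| :=
  ⟨round a, by rw [AddCircle.norm_eq]; simp⟩

lemma exists_rep_coe (a : ℝ) : ∃ k : ℤ, rep (a : AddCircle (1 : ℝ)) = a - k := by
  have h := coe_rep (a : AddCircle (1 : ℝ))
  rw [← sub_eq_zero, ← AddCircle.coe_sub, AddCircle.coe_eq_zero_iff] at h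
  obtain ⟨k, hk⟩ := h
  refine ⟨-k, ?_⟩
  rw [zsmul_one] at hk
  push_cast
  linarith

lemma nu_eq_some_true {θ : AddCircle (1 : ℝ)} {k : ℕ} (h : nu θ k = some true) :
    rep θ / 2 < rep ((2 ^ (k - 1) : ℕ) • θ) ∧
      rep ((2 ^ (k - 1) : ℕ) • θ) < (rep θ + 1) / 2 := by
  simp only [nu] at h
  split_ifs at h with h₁ h₂
  · exact h₂
  · simp at h

lemma nu_eq_some_false {θ : AddCircle (1 : ℝ)} {k : ℕ} (h : nu θ k = some false) :
    rep ((2 ^ (k - 1) : ℕ) • θ) < rep θ / 2 ∨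
      (rep θ + 1) / 2 < rep ((2 ^ (k - 1) : ℕ) • θ) := by
  simp only [nu] at h
  split_ifs at h with h₁ h₂
  · simp at h
  · grind

lemma exists_ne_of_diffW_eq {a b : ℕ → Option Bool} {d : ℕ} (h : diffW a b = d) :
    1 ≤ d ∧ ∃ x y : Bool, a d = some x ∧ b d = some y ∧ x ≠ y := by
  unfold diffW at h
  set S := {k : ℕ∞ | ∃ n : ℕ, k = (n : ℕ∞) ∧ 1 ≤ n ∧
    ∃ x y : Bool, a n = some x ∧ b n = some y ∧ x ≠ y} with hS
  have hne : S.Nonempty := by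
    by_contra! h0
    simp [h0] at h
  obtain ⟨n, hn, h1, hxy⟩ := csInf_mem hne
  rw [h, Nat.cast_inj] at hn
  exact hn ▸ ⟨h1, hxy⟩

/-- A non-recurrent orbit stays at a definite distance from its starting angle. -/
lemma exists_dist_lower_bound {θ : AddCircle (1 : ℝ)} (h : ¬ DoublingRecurrent θ) :
    ∃ ε : ℝ, 0 < ε ∧ ∀ m : ℕ, 1 ≤ m → ε ≤ dist ((2 ^ m : ℕ) • θ) θ := by
  rw [DoublingRecurrent, Metric.mem_closure_iff] at h
  push Not at h
  obtain ⟨ε, hε, h⟩ := h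
  exact ⟨ε, hε, fun m hm ↦ by rw [dist_comm]; exact h _ ⟨m, hm, rfl⟩⟩

lemma abs_rep_sub_rep_eq_dist {θ φ : AddCircle (1 : ℝ)} (h₀ : dist φ θ < rep θ)
    (h₁ : dist φ θ < 1 - rep θ) : |rep φ - rep θ| = dist φ θ := by
  have h : dist φ θ = ‖((rep φ - rep θ : ℝ) : AddCircle (1 : ℝ))‖ := by
    rw [AddCircle.coe_sub, coe_rep, coe_rep, dist_eq_norm]
  obtain ⟨k, hk⟩ := exists_int_norm_coe (rep φ - rep θ)
  rw [hk] at h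
  obtain ⟨hφ₀, hφ₁⟩ := rep_mem φ
  have hk0 : k = 0 := by
    rw [h, abs_lt] at h₀ h₁
    have h₂ : (k : ℝ) < 1 := by linarith
    have h₃ : (-1 : ℝ) < k := by linarith
    have : k < 1 := by exact_mod_cast h₂
    have : -1 < k := by exact_mod_cast h₃
    omega
  simpa [hk0] using h.symm

/-- Let `x, t` and `y, s` be points of `[0,1)` such that `2x` is at circle distance at least `ε`
from `t`. If `2x - t` and `2y - s` differ by less than `ε` modulo `2`, then `x` and `y` lie
on corresponding sides of the partitions given by `t` and `s`. -/
lemma arc_true_of_near {ε x t y s u v : ℝ} {j : ℤ}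
    (hy : 0 ≤ y ∧ y < 1) (hs : 0 ≤ s ∧ s < 1)
    (hgap : ∀ k : ℤ, ε ≤ |2 * x - t - k|) (hyx : y = x + u + j) (hst : s = t + v)
    (huv : |2 * u| + |v| < ε) (h : t / 2 < x ∧ x < (t + 1) / 2) :
    s / 2 < y ∧ y < (s + 1) / 2 := by
  have g0 := hgap 0
  have g1 := hgap 1
  rw [Int.cast_zero, sub_zero, abs_of_pos (by linarith)] at g0
  rw [Int.cast_one, abs_of_neg (by linarith)] at g1
  have := neg_abs_le (2 * u)
  have := le_abs_self (2 * u)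
  have := neg_abs_le v
  have := le_abs_self v
  have h₂ : (j : ℝ) < 1 := by linarith
  have h₃ : (-1 : ℝ) < j := by linarith
  have h₂ : j < 1 := by exact_mod_cast h₂
  have h₃ : -1 < j := by exact_mod_cast h₃
  obtain rfl : j = 0 := by omega
  rw [Int.cast_zero] at hyx
  constructor <;> linarith

lemma not_arc_true_of_near {ε x t y s u v : ℝ} {j : ℤ}
    (hx : 0 ≤ x ∧ x < 1) (ht : 0 ≤ t ∧ t < 1)
    (hgap : ∀ k : ℤ, ε ≤ |2 * x - t - k|) (hyx : y = x + u + j) (hst : s = t + v)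
    (huv : |2 * u| + |v| < ε) (h : x < t / 2 ∨ (t + 1) / 2 < x) :
    ¬ (s / 2 < y ∧ y < (s + 1) / 2) := by
  rintro ⟨hl, hr⟩
  have g0 := hgap 0
  have g1 := hgap 1
  have g2 := hgap 2
  have g3 := hgap (-1)
  push_cast at g0 g1 g2 g3
  have := neg_abs_le (2 * u)
  have := le_abs_self (2 * u)
  have := neg_abs_le v
  have := le_abs_self v
  rcases h with h | h
  · rw [abs_of_neg (by linarith)] at g0
    rw [abs_of_pos (by linarith)] at g3
    have h₂ : (j : ℝ) < 1 := by linarith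
    have h₃ : (0 : ℝ) < j := by linarith
    have h₂ : j < 1 := by exact_mod_cast h₂
    have h₃ : 0 < j := by exact_mod_cast h₃
    omega
  · rw [abs_of_pos (by linarith)] at g1
    rw [abs_of_neg (by linarith)] at g2
    have h₂ : (j : ℝ) < 0 := by linarith
    have h₃ : (-1 : ℝ) < j := by linarith
    have h₂ : j < 0 := by exact_mod_cast h₂
    have h₃ : -1 < j := by exact_mod_cast h₃
    omega

/-- If `θ` returns no closer than `ε` to itself at time `d`, then an angle `φ` near `θ` can have
a different `d`-th kneading entry only if `(2 ^ d + 1) * dist φ θ ≥ ε`. -/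
lemma le_dist_of_nu_ne {θ φ : AddCircle (1 : ℝ)} {ε : ℝ} {d : ℕ} {a b : Bool} (hd : 1 ≤ d)
    (hε : ε ≤ dist ((2 ^ d : ℕ) • θ) θ) (h₀ : dist φ θ < rep θ) (h₁ : dist φ θ < 1 - rep θ)
    (ha : nu θ d = some a) (hb : nu φ d = some b) (hab : a ≠ b) :
    ε ≤ (2 ^ d + 1) * dist φ θ := by
  by_contra! hlt
  have hη := abs_rep_sub_rep_eq_dist h₀ h₁
  obtain ⟨e, rfl⟩ : ∃ e, d = e + 1 := ⟨d - 1, by omega⟩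
  have lift (ψ : AddCircle (1 : ℝ)) :
      (2 ^ e : ℕ) • ψ = ((2 ^ e * rep ψ : ℝ) : AddCircle (1 : ℝ)) := by
    conv_lhs => rw [← coe_rep ψ]
    rw [← AddCircle.coe_nsmul, nsmul_eq_mul]
    push_cast
    rfl
  obtain ⟨k, hk⟩ := exists_rep_coe (2 ^ e * rep θ)
  obtain ⟨l, hl⟩ := exists_rep_coe (2 ^ e * rep φ)
  rw [← lift] at hk hl
  set x := rep ((2 ^ e : ℕ) • θ) with hx
  set y := rep ((2 ^ e : ℕ) • φ) with hy
  have hgap (i : ℤ) : ε ≤ |2 * x - rep θ - i| := by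
    refine hε.trans (le_trans (le_of_eq ?_) (norm_coe_le_abs_sub_int _ i))
    rw [dist_eq_norm, AddCircle.coe_sub, coe_rep, pow_succ', mul_smul, two_nsmul, two_mul,
      AddCircle.coe_add, hx, coe_rep]
  have hyx : y = x + 2 ^ e * (rep φ - rep θ) + ((k - l : ℤ) : ℝ) := by
    rw [hk, hl]; push_cast; ring
  have hst : rep φ = rep θ + (rep φ - rep θ) := by ring
  have huv : |2 * (2 ^ e * (rep φ - rep θ))| + |rep φ - rep θ| < ε := by
    rw [← mul_assoc, abs_mul, hη, abs_of_pos (by positivity)]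
    rw [pow_succ'] at hlt
    linarith
  have hmx := rep_mem ((2 ^ e : ℕ) • θ)
  have hmy := rep_mem ((2 ^ e : ℕ) • φ)
  cases a <;> cases b <;> try exact hab rfl
  · exact not_arc_true_of_near hmx (rep_mem θ) hgap hyx hst huv (nu_eq_some_false ha)
      (nu_eq_some_true hb)
  · have := arc_true_of_near hmy (rep_mem φ) hgap hyx hst huv (nu_eq_some_true ha)
    rcases nu_eq_some_false hb with h | h
    · exact lt_asymm this.1 h
    · exact lt_asymm this.2 h

lemma two_pow_mul_le_rpow {c η : ℝ} {n d : ℕ} (hc : c < 1) (hη : 0 ≤ η)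
    (h₁ : (2 : ℝ) ^ (-(n : ℤ) - 1) ≤ η) (h₂ : η < (2 : ℝ) ^ (-(n : ℤ))) (hd : (d : ℝ) ≤ c * n) :
    2 ^ d * η ≤ (2 * η) ^ (1 - c) := by
  have e : (2 : ℝ) ^ (-(n : ℤ)) = (2 : ℝ) ^ (-(n : ℝ)) := by
    rw [← Real.rpow_intCast]; push_cast; rfl
  have h₃ : (2 : ℝ) ^ (-(n : ℝ)) ≤ 2 * η := by
    rw [← e]
    rw [zpow_sub₀ two_ne_zero, zpow_one] at h₁
    linarith
  calc 2 ^ d * η ≤ (2 : ℝ) ^ (c * n) * (2 : ℝ) ^ (-(n : ℝ)) := by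
        rw [← e, ← Real.rpow_natCast]
        gcongr
        norm_num
    _ = ((2 : ℝ) ^ (-(n : ℝ))) ^ (1 - c) := by
        rw [← Real.rpow_add two_pos, ← Real.rpow_mul two_pos.le]
        ring_nf
    _ ≤ (2 * η) ^ (1 - c) := by
        gcongr

/-- If `θ` is non-periodic and non-recurrent under doubling, then for every `c ∈ (0,1)`
there is `δ > 0` such that every `φ` with `0 < dist(φ,θ) < δ` satisfies
`diff(ν(θ),ν(φ)) > c·n`, where `n` is the unique integer with
`2^{-n-1} ≤ dist(φ,θ) < 2^{-n}`.  (The case `diff = ∞` trivially satisfies the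
conclusion, so it is phrased for finite values `d` of the diff.) -/
theorem diff_large_nonrecurrent (θ : AddCircle (1 : ℝ))
    (hnp : ¬ DoublingPeriodic θ) (hnr : ¬ DoublingRecurrent θ) :
    ∀ c : ℝ, 0 < c → c < 1 → ∃ δ : ℝ, 0 < δ ∧ ∀ φ : AddCircle (1 : ℝ),
      0 < dist φ θ → dist φ θ < δ →
      ∀ n : ℕ, (2 : ℝ) ^ (-(n : ℤ) - 1) ≤ dist φ θ → dist φ θ < (2 : ℝ) ^ (-(n : ℤ)) →
      ∀ d : ℕ, diffW (nu θ) (nu φ) = (d : ℕ∞) → c * n < (d : ℝ) := by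
  intro c hc₀ hc₁
  obtain ⟨ε, hε, hret⟩ := exists_dist_lower_bound hnr
  have hθ : 0 < rep θ := by
    refine lt_of_le_of_ne (rep_mem θ).1 fun h ↦ hnp ⟨1, le_rfl, ?_⟩
    have : θ = 0 := by rw [← coe_rep θ, ← h, AddCircle.coe_zero]
    simp [this]
  have hθ' : 0 < 1 - rep θ := sub_pos.2 (rep_mem θ).2
  set r : ℝ := (ε / 2) ^ (1 - c)⁻¹ with hr
  have hr₀ : 0 < r := by positivity
  refine ⟨min (min (rep θ) (1 - rep θ)) (min (r / 2) (ε / 2)), by positivity, ?_⟩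
  intro φ hpos hlt n hn₁ hn₂ d hdiff
  simp only [lt_min_iff] at hlt
  obtain ⟨⟨h₀, h₁⟩, h₂, h₃⟩ := hlt
  obtain ⟨hd, a, b, ha, hb, hab⟩ := exists_ne_of_diffW_eq hdiff
  by_contra! hcon
  have hmain := le_dist_of_nu_ne hd (hret d hd) h₀ h₁ ha hb hab
  have hpow := two_pow_mul_le_rpow hc₁ hpos.le hn₁ hn₂ hcon
  have hsmall : (2 * dist φ θ) ^ (1 - c) < ε / 2 := by
    calc (2 * dist φ θ) ^ (1 - c) < r ^ (1 - c) :=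
          Real.rpow_lt_rpow (by positivity) (by linarith) (by linarith)
      _ = ε / 2 := Real.rpow_inv_rpow (by positivity) (by linarith)
  linarith
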